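/- arXiv:2004.07217 — 2 statements merged into one kernel-verified Lean document; each statement's English description precedes it below -/
import Mathlib

section
/- Let h : [0,1] → [0,1] be the step function defined by h(σ) = 0.971239 for σ ∈ [0, 0.236901) and h(σ) = 0.873362 for σ ∈ [0.236901, 1]. Then for every z ∈ [0,1], ∫_z^1 max{0, h(σ) − 1 + z·h(σ)} dσ + ∫_0^z (h(σ) − 1 − z·h(σ)) dσ ≤ 0. -/
theorem intervalIntegral_of_eqOn_const {f : ℝ → ℝ} {p q c : ℝ} (hpq : p ≤ q)
    (hf : ∀ σ ∈ Set.Ioo p q, f σ = c) :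
    IntervalIntegrable f MeasureTheory.volume p q ∧ ∫ σ in p..q, f σ = (q - p) * c := by
  have hae : f =ᵐ[MeasureTheory.volume.restrict (Set.uIoc p q)] fun _ => c := by
    rw [Set.uIoc_of_le hpq, MeasureTheory.Measure.restrict_congr_set
      MeasureTheory.Ioo_ae_eq_Ioc.symm]
    exact (MeasureTheory.ae_restrict_iff' measurableSet_Ioo).2 (.of_forall hf)
  refine ⟨(intervalIntegrable_const (c := c)).congr_ae hae.symm, ?_⟩
  rw [intervalIntegral.integral_congr_ae_restrict hae]
  simp

theorem stmt_0 (h : ℝ → ℝ)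
    (hh : ∀ σ ∈ Set.Icc (0:ℝ) 1,
      h σ = if σ < 0.236901 then (0.971239 : ℝ) else (0.873362 : ℝ)) :
    ∀ z ∈ Set.Icc (0:ℝ) 1,
      (∫ σ in z..1, max 0 (h σ - 1 + z * h σ)) +
        (∫ σ in (0:ℝ)..z, (h σ - 1 - z * h σ)) ≤ 0 := by
  rintro z ⟨hz0, hz1⟩
  have hα : ∀ σ, 0 ≤ σ → σ < 0.236901 → h σ = 0.971239 := fun σ h0 h1 => by
    rw [hh σ ⟨h0, by linarith⟩, if_pos h1]
  have hβ : ∀ σ, 0.236901 ≤ σ → σ ≤ 1 → h σ = 0.873362 := fun σ h0 h1 => by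
    rw [hh σ ⟨by linarith, h1⟩, if_neg (not_lt.2 h0)]
  rcases le_total z 0.236901 with hzx | hzx
  · obtain ⟨i₁, e₁⟩ := intervalIntegral_of_eqOn_const
      (f := fun σ => max 0 (h σ - 1 + z * h σ)) hzx
      (c := max 0 (0.971239 - 1 + z * 0.971239))
      fun σ hσ => by simp only [hα σ (hz0.trans hσ.1.le) hσ.2]
    obtain ⟨i₂, e₂⟩ := intervalIntegral_of_eqOn_const
      (f := fun σ => max 0 (h σ - 1 + z * h σ)) (p := 0.236901) (q := 1) (by norm_num)
      (c := max 0 (0.873362 - 1 + z * 0.873362))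
      fun σ hσ => by simp only [hβ σ hσ.1.le hσ.2.le]
    obtain ⟨-, e₃⟩ := intervalIntegral_of_eqOn_const
      (f := fun σ => h σ - 1 - z * h σ) hz0
      (c := 0.971239 - 1 - z * 0.971239)
      fun σ hσ => by simp only [hα σ hσ.1.le (hσ.2.trans_le hzx)]
    rw [← intervalIntegral.integral_add_adjacent_intervals i₁ i₂, e₁, e₂, e₃]
    rcases max_cases (0 : ℝ) (0.971239 - 1 + z * 0.971239) with ⟨m₁, _⟩ | ⟨m₁, _⟩ <;>
    rcases max_cases (0 : ℝ) (0.873362 - 1 + z * 0.873362) with ⟨m₂, _⟩ | ⟨m₂, _⟩ <;>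
    rw [m₁, m₂]
    · nlinarith
    · linarith
    · nlinarith [sq_nonneg (z - 0.236901 / 4)]
    · nlinarith [sq_nonneg (z - 0.2307756)]
  · obtain ⟨-, e₁⟩ := intervalIntegral_of_eqOn_const
      (f := fun σ => max 0 (h σ - 1 + z * h σ)) hz1
      (c := max 0 (0.873362 - 1 + z * 0.873362))
      fun σ hσ => by simp only [hβ σ (hzx.trans hσ.1.le) hσ.2.le]
    obtain ⟨i₂, e₂⟩ := intervalIntegral_of_eqOn_const
      (f := fun σ => h σ - 1 - z * h σ) (p := 0) (q := 0.236901) (by norm_num)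
      (c := 0.971239 - 1 - z * 0.971239)
      fun σ hσ => by simp only [hα σ hσ.1.le hσ.2]
    obtain ⟨i₃, e₃⟩ := intervalIntegral_of_eqOn_const
      (f := fun σ => h σ - 1 - z * h σ) hzx
      (c := 0.873362 - 1 - z * 0.873362)
      fun σ hσ => by simp only [hβ σ hσ.1.le (hσ.2.le.trans hz1)]
    rw [← intervalIntegral.integral_add_adjacent_intervals i₂ i₃, e₁, e₂, e₃,
      max_eq_right (by linarith)]
    nlinarith [sq_nonneg (z - 0.243363)]
end

section
/- There exist real numbers α, β, x with 0 < α < 1, 0 < β < α and 0 < x < 1 such that β = (2/3)·(−45 + 172·α − 128·α²), x = 8·(1/α − 1), the three equations (x·α)² + 8·α·(x·α − x) = 0, (x·α + (1−x)·β)² + 8·α·(x·α − 1 + (1−x)·β) = 0 and (−x·α + (x+1)·β)² + 8·β·(x·α − 1 + (1−x)·β) = 0 all hold, and moreover 1 + 1/(1 + x·α + (1−x)·β) < 1.5273. -/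
theorem exists_root_cubic :
    ∃ a : ℝ, 0.971238 ≤ a ∧ a ≤ 0.97124 ∧ 256 * a ^ 3 - 544 * a ^ 2 + 361 * a - 72 = 0 := by
  have hc : ContinuousOn (fun a : ℝ => 256 * a ^ 3 - 544 * a ^ 2 + 361 * a - 72)
      (Set.Icc 0.971238 0.97124) := by fun_prop
  obtain ⟨a, ha, h⟩ := intermediate_value_Icc (by norm_num) hc
    (show (0 : ℝ) ∈ _ by constructor <;> norm_num)
  exact ⟨a, ha.1, ha.2, h⟩

theorem stmt_11 :
    ∃ α β x : ℝ, 0 < α ∧ α < 1 ∧ 0 < β ∧ β < α ∧ 0 < x ∧ x < 1 ∧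
      β = (2 / 3) * (-45 + 172 * α - 128 * α ^ 2) ∧
      x = 8 * (1 / α - 1) ∧
      (x * α) ^ 2 + 8 * α * (x * α - x) = 0 ∧
      (x * α + (1 - x) * β) ^ 2 + 8 * α * (x * α - 1 + (1 - x) * β) = 0 ∧
      (-(x * α) + (x + 1) * β) ^ 2 + 8 * β * (x * α - 1 + (1 - x) * β) = 0 ∧
      1 + 1 / (1 + x * α + (1 - x) * β) < 1.5273 := by
  obtain ⟨a, h₁, h₂, h⟩ := exists_root_cubic
  have ha : 0 < a := by linarith
  obtain ⟨b, hb⟩ : ∃ b, b = (2 / 3) * (-45 + 172 * a - 128 * a ^ 2) := ⟨_, rfl⟩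
  obtain ⟨x, hx⟩ : ∃ x, x = 8 * (1 / a - 1) := ⟨_, rfl⟩
  have hxa : x * a = 8 - 8 * a := by rw [hx]; field_simp
  have hb₁ : 0.87335 < b := by rw [hb]; nlinarith
  have hb₂ : b < 0.87338 := by rw [hb]; nlinarith
  have hx₁ : 0.23689 < x := by nlinarith
  have hx₂ : x < 0.23692 := by nlinarith
  refine ⟨a, b, x, ha, by linarith, by linarith, by linarith, by linarith, by linarith,
    hb, hx, ?_, ?_, ?_, ?_⟩
  · linear_combination x * a * hxa
  · have key : a ^ 2 * ((x * a + (1 - x) * b) ^ 2 + 8 * a * (x * a - 1 + (1 - x) * b)) = 0 := by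
      have e : a * (x * a + (1 - x) * b) = (8 - 8 * a) * a + (9 * a - 8) * b := by
        linear_combination (a - b) * hxa
      calc _ = (a * (x * a + (1 - x) * b)) ^ 2
            + 8 * a ^ 2 * (a * (x * a + (1 - x) * b) - a) := by ring
        _ = 0 := by
          rw [e, hb]
          linear_combination (-204800 + 8872960 / 9 * a - 1374208 * a ^ 2 + 589824 * a ^ 3)
            / 256 * h
    exact (mul_eq_zero.mp key).resolve_left (by positivity)
  · have key : a ^ 2 * ((-(x * a) + (x + 1) * b) ^ 2
        + 8 * b * (x * a - 1 + (1 - x) * b)) = 0 := by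
      have e : a * (x * a + (1 - x) * b) = (8 - 8 * a) * a + (9 * a - 8) * b := by
        linear_combination (a - b) * hxa
      have e' : a * (-(x * a) + (x + 1) * b) = -(8 - 8 * a) * a + (8 - 7 * a) * b := by
        linear_combination (b - a) * hxa
      calc _ = (a * (-(x * a) + (x + 1) * b)) ^ 2
            + 8 * a * b * (a * (x * a + (1 - x) * b) - a) := by ring
        _ = 0 := by
          rw [e, e', hb]
          linear_combination (-204800 + 9794560 / 9 * a - 15859712 / 9 * a ^ 2
            + 7929856 / 9 * a ^ 3) / 256 * h
    exact (mul_eq_zero.mp key).resolve_left (by positivity)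
  · have hw : 0.8965 < x * a + (1 - x) * b := by nlinarith
    have hlt : 1 / (1 + x * a + (1 - x) * b) < 0.5273 := by
      rw [div_lt_iff₀ (by linarith)]
      linarith
    linarith
end
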